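/- arXiv:1610.08335 — 2 statements merged into one kernel-verified Lean document; each statement's English description precedes it below -/
import Mathlib

section
/- If u ∈ C²(Ω) solves Δu + f(x,u) = 0 on an open set Ω ⊆ ℝⁿ, and z(x) = x · ∇u(x), then z satisfies Δz + f_u(x,u)z = -2f(x,u) - Σᵢ xᵢ f_{xᵢ}(x,u) on Ω. -/
open MeasureTheory Set Real
open scoped RealInnerProductSpace
noncomputable section

abbrev Euc (n : ℕ) := EuclideanSpace ℝ (Fin n)

/-- The partial derivative of `f` in the `i`-th coordinate direction. -/
def pd {n : ℕ} (f : Euc n → ℝ) (i : Fin n) (x : Euc n) : ℝ :=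
  fderiv ℝ f x (EuclideanSpace.single i 1)

/-- The Laplacian of `f`. -/
def lap {n : ℕ} (f : Euc n → ℝ) (x : Euc n) : ℝ :=
  ∑ i, pd (fun y => pd f i y) i x

theorem pd_contDiffOn {n : ℕ} {Ω : Set (Euc n)} (hΩ : IsOpen Ω) {g : Euc n → ℝ} {m k : WithTop ℕ∞}
    (hg : ContDiffOn ℝ k g Ω) (hmk : m + 1 ≤ k) (i : Fin n) :
    ContDiffOn ℝ m (fun y => pd g i y) Ω :=
  (hg.fderiv_of_isOpen hΩ hmk).clm_apply contDiffOn_const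

theorem pd_congr {n : ℕ} {Ω : Set (Euc n)} (hΩ : IsOpen Ω) {g h : Euc n → ℝ}
    (hgh : ∀ y ∈ Ω, g y = h y) (i : Fin n) : ∀ x ∈ Ω, pd g i x = pd h i x := by
  intro x hx
  have : g =ᶠ[nhds x] h := Filter.eventually_of_mem (hΩ.mem_nhds hx) hgh
  unfold pd
  rw [this.fderiv_eq]

theorem pd_comm {n : ℕ} {Ω : Set (Euc n)} (hΩ : IsOpen Ω) {g : Euc n → ℝ}
    (hg : ContDiffOn ℝ 2 g Ω) (i j : Fin n) :
    ∀ x ∈ Ω, pd (fun y => pd g i y) j x = pd (fun y => pd g j y) i x := by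
  intro x hx
  have hat : ContDiffAt ℝ 2 g x := hg.contDiffAt (hΩ.mem_nhds hx)
  have hd : DifferentiableAt ℝ (fderiv ℝ g) x :=
    (hat.fderiv_right (m := 1) (by norm_num)).differentiableAt (by norm_num)
  have key : ∀ v w : Euc n, fderiv ℝ (fun y => fderiv ℝ g y v) x w
      = fderiv ℝ (fderiv ℝ g) x w v := by
    intro v w
    rw [fderiv_clm_apply hd (differentiableAt_const v)]
    simp
  have hs : IsSymmSndFDerivAt ℝ g x := hat.isSymmSndFDerivAt (by simp)
  unfold pd
  rw [key, key]
  exact hs _ _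

theorem pd_add' {n : ℕ} {g h : Euc n → ℝ} {x : Euc n} (hg : DifferentiableAt ℝ g x)
    (hh : DifferentiableAt ℝ h x) (i : Fin n) :
    pd (fun y => g y + h y) i x = pd g i x + pd h i x := by
  unfold pd
  rw [fderiv_fun_add hg hh]; rfl

theorem pd_sum' {n : ℕ} {g : Fin n → Euc n → ℝ} {x : Euc n}
    (hg : ∀ j, DifferentiableAt ℝ (g j) x) (i : Fin n) :
    pd (fun y => ∑ j, g j y) i x = ∑ j, pd (g j) i x := by
  unfold pd
  rw [fderiv_fun_sum (fun j _ => hg j)]; simp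

theorem pd_coord_mul {n : ℕ} {g : Euc n → ℝ} {x : Euc n}
    (hg : DifferentiableAt ℝ g x) (i j : Fin n) :
    pd (fun y => y j * g y) i x = (if j = i then g x else 0) + x j * pd g i x := by
  have h1 : HasFDerivAt (fun y : Euc n => y j) (EuclideanSpace.proj (𝕜 := ℝ) j : Euc n →L[ℝ] ℝ) x :=
    (EuclideanSpace.proj (𝕜 := ℝ) j : Euc n →L[ℝ] ℝ).hasFDerivAt
  unfold pd
  rw [(h1.fun_mul hg.hasFDerivAt).fderiv]
  by_cases h : j = i <;> simp [h, add_comm]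

theorem coord_mul_diff {n : ℕ} {g : Euc n → ℝ} {x : Euc n}
    (hg : DifferentiableAt ℝ g x) (j : Fin n) :
    DifferentiableAt ℝ (fun y : Euc n => y j * g y) x :=
  ((EuclideanSpace.proj (𝕜 := ℝ) j : Euc n →L[ℝ] ℝ).differentiableAt).mul hg

theorem pd_radial {n : ℕ} {g : Fin n → Euc n → ℝ} {x : Euc n}
    (hg : ∀ j, DifferentiableAt ℝ (g j) x) (i : Fin n) :
    pd (fun y => ∑ j, y j * g j y) i x = g i x + ∑ j, x j * pd (g j) i x := by
  rw [pd_sum' (g := fun j y => y j * g j y) (fun j => coord_mul_diff (hg j) j)]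
  simp only [pd_coord_mul (hg _), Finset.sum_add_distrib]
  simp

theorem pd_chain {n : ℕ} {f : Euc n → ℝ → ℝ} {u : Euc n → ℝ} {x : Euc n}
    (hf : DifferentiableAt ℝ (fun p : Euc n × ℝ => f p.1 p.2) (x, u x))
    (hu : DifferentiableAt ℝ u x) (i : Fin n) :
    pd (fun y => f y (u y)) i x
      = pd (fun y => f y (u x)) i x + deriv (fun t => f x t) (u x) * pd u i x := by
  set L := fderiv ℝ (fun p : Euc n × ℝ => f p.1 p.2) (x, u x)
  have hL : HasFDerivAt (fun p : Euc n × ℝ => f p.1 p.2) L (x, u x) := hf.hasFDerivAt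
  have h1 : HasFDerivAt (fun y => f y (u y))
      (L.comp ((ContinuousLinearMap.id ℝ (Euc n)).prod (fderiv ℝ u x))) x :=
    HasFDerivAt.comp (f := fun y => (y, u y)) x hL ((hasFDerivAt_id x).prodMk hu.hasFDerivAt)
  have h2 : HasFDerivAt (fun y => f y (u x))
      (L.comp ((ContinuousLinearMap.id ℝ (Euc n)).prod 0)) x :=
    HasFDerivAt.comp (f := fun y => (y, u x)) x hL
      ((hasFDerivAt_id x).prodMk (hasFDerivAt_const (u x) x))
  have h3 : HasDerivAt (fun t => f x t) (L (0, 1)) (u x) :=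
    HasFDerivAt.comp_hasDerivAt (f := fun t => (x, t)) (u x) hL
      ((hasDerivAt_const (u x) x).prodMk (hasDerivAt_id (u x)))
  unfold pd
  rw [h1.fderiv, h2.fderiv, h3.deriv]
  simp only [ContinuousLinearMap.comp_apply, ContinuousLinearMap.prod_apply,
    ContinuousLinearMap.id_apply, ContinuousLinearMap.zero_apply]
  rw [mul_comm, ← smul_eq_mul, ← map_smul, ← map_add]
  simp

/-- if `Δu + f(x,u) = 0` on the open set `Ω` and `z = x·∇u`, then
`Δz + f_u(x,u) z = -2 f(x,u) - Σᵢ xᵢ f_{xᵢ}(x,u)` on `Ω`. -/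
theorem stmt0 {n : ℕ} (Ω : Set (Euc n)) (hΩ : IsOpen Ω)
    (f : Euc n → ℝ → ℝ)
    (hf : ContDiffOn ℝ 1 (fun p : Euc n × ℝ => f p.1 p.2) (Ω ×ˢ (univ : Set ℝ)))
    (u : Euc n → ℝ) (hu : ContDiffOn ℝ 3 u Ω)
    (heq : ∀ x ∈ Ω, lap u x + f x (u x) = 0)
    (z : Euc n → ℝ) (hz : z = fun x => ∑ i, x i * pd u i x) :
    ∀ x ∈ Ω,
      lap z x + deriv (fun t => f x t) (u x) * z x =
        -2 * f x (u x) - ∑ i, x i * pd (fun y => f y (u x)) i x := by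
  intro x hx
  have hu1 : ∀ i, ContDiffOn ℝ 2 (fun y => pd u i y) Ω :=
    fun i => pd_contDiffOn hΩ hu (by norm_num) i
  have hu2 : ∀ i j, ContDiffOn ℝ 1 (fun y => pd (fun w => pd u i w) j y) Ω :=
    fun i j => pd_contDiffOn hΩ (hu1 i) (by norm_num) j
  have d1 : ∀ i, ∀ y ∈ Ω, DifferentiableAt ℝ (fun y => pd u i y) y := fun i y hy =>
    ((hu1 i).contDiffAt (hΩ.mem_nhds hy)).differentiableAt (by norm_num)
  have d2 : ∀ i j, ∀ y ∈ Ω, DifferentiableAt ℝ (fun y => pd (fun w => pd u i w) j y) y :=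
    fun i j y hy => ((hu2 i j).contDiffAt (hΩ.mem_nhds hy)).differentiableAt (by norm_num)
  have hz1 : ∀ i, ∀ y ∈ Ω,
      pd z i y = pd u i y + ∑ j, y j * pd (fun w => pd u j w) i y := by
    intro i y hy
    rw [hz]
    exact pd_radial (g := fun j y => pd u j y) (fun j => d1 j y hy) i
  have hz2 : ∀ i, pd (fun y => pd z i y) i x
      = 2 * pd (fun y => pd u i y) i x
        + ∑ j, x j * pd (fun y => pd (fun w => pd u i w) i y) j x := by
    intro i
    rw [pd_congr hΩ (hz1 i) i x hx,
      pd_add' (d1 i x hx)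
        (DifferentiableAt.fun_sum fun j _ => coord_mul_diff (d2 j i x hx) j),
      pd_radial (g := fun j y => pd (fun w => pd u j w) i y) (fun j => d2 j i x hx) i]
    have : ∀ j, pd (fun y => pd (fun w => pd u j w) i y) i x
        = pd (fun y => pd (fun w => pd u i w) i y) j x := by
      intro j
      rw [pd_congr hΩ (pd_comm hΩ (hu.of_le (by norm_num)) j i) i x hx]
      exact pd_comm hΩ (hu1 i) j i x hx
    simp only [this]
    ring
  have hl : ∀ j, ∑ i, pd (fun y => pd (fun w => pd u i w) i y) j x
      = -(pd (fun y => f y (u x)) j x + deriv (fun t => f x t) (u x) * pd u j x) := by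
    intro j
    rw [← pd_sum' (fun i => d2 i i x hx) j, ← pd_chain
      ((hf.contDiffAt ((hΩ.prod isOpen_univ).mem_nhds ⟨hx, mem_univ _⟩)).differentiableAt
        (by norm_num))
      ((hu.contDiffAt (hΩ.mem_nhds hx)).differentiableAt (by norm_num))]
    rw [pd_congr hΩ (h := fun y => -(f y (u y)))
      (fun y hy => by have := heq y hy; unfold lap at this; linarith) j x hx]
    unfold pd
    rw [fderiv_fun_neg]; rfl
  have h0 := heq x hx
  have hlz : lap z x = 2 * lap u x + ∑ j, x j *
      -(pd (fun y => f y (u x)) j x + deriv (fun t => f x t) (u x) * pd u j x) := by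
    unfold lap
    simp only [hz2, ← hl, Finset.sum_add_distrib, Finset.mul_sum]
    rw [Finset.sum_comm]
  have hzx : z x = ∑ i, x i * pd u i x := by rw [hz]
  have hsum : ∑ j, x j *
      -(pd (fun y => f y (u x)) j x + deriv (fun t => f x t) (u x) * pd u j x)
      = -(∑ i, x i * pd (fun y => f y (u x)) i x)
        - deriv (fun t => f x t) (u x) * ∑ i, x i * pd u i x := by
    rw [Finset.mul_sum, ← Finset.sum_neg_distrib, ← Finset.sum_sub_distrib]
    exact Finset.sum_congr rfl fun j _ => by ring
  rw [hlz, hsum, hzx]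
  linarith
end
end

section
/- If Ω ⊂ ℝⁿ (n ≥ 3) is a bounded smooth domain that is star-shaped with respect to the origin (x·ν ≥ 0 on ∂Ω) and p > (n+2)/(n-2), then the problem Δu + u|u|^{p-1} = 0 in Ω, u = 0 on ∂Ω, has no nontrivial classical solution. -/
open MeasureTheory Set Real
open scoped RealInnerProductSpace
noncomputable section

open Filter Topology Metric in
lemma grad_bdd {n : ℕ} {Ω : Set (Euc n)} (hΩ : IsOpen Ω)
    (hΩb : Bornology.IsBounded Ω) {u : Euc n → ℝ} (hu : ContDiffOn ℝ 1 u (closure Ω)) :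
    ∃ M : ℝ, 1 ≤ M ∧ ∀ x ∈ Ω, ‖fderiv ℝ u x‖ ≤ M := by
  have hK : IsCompact (closure Ω) := hΩb.isCompact_closure
  have key : ∃ M : ℝ, 1 ≤ M ∧ ∀ x ∈ closure Ω ∩ Ω, ‖fderiv ℝ u x‖ ≤ M := by
    refine hK.induction_on (p := fun s => ∃ M : ℝ, 1 ≤ M ∧ ∀ x ∈ s ∩ Ω, ‖fderiv ℝ u x‖ ≤ M)
      ⟨1, le_rfl, by simp⟩ ?_ ?_ ?_
    · rintro s t hst ⟨M, h1, h⟩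
      exact ⟨M, h1, fun x hx => h x ⟨hst hx.1, hx.2⟩⟩
    · rintro s t ⟨M, h1, h⟩ ⟨N, h2, h'⟩
      refine ⟨max M N, le_max_of_le_left h1, ?_⟩
      rintro x ⟨hx | hx, hxΩ⟩
      · exact (h x ⟨hx, hxΩ⟩).trans (le_max_left _ _)
      · exact (h' x ⟨hx, hxΩ⟩).trans (le_max_right _ _)
    · intro x hx
      have h := hu x hx
      rw [show (1 : WithTop ℕ∞) = 0 + 1 by simp,
        contDiffWithinAt_succ_iff_hasFDerivWithinAt' (by simp)] at h
      obtain ⟨v, hv, -, -, f', hf', hc⟩ := h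
      rw [insert_eq_of_mem hx] at hv
      have hc' : ContinuousWithinAt f' (closure Ω) x := hc.continuousWithinAt
      have hb : ∀ᶠ y in 𝓝[closure Ω] x, ‖f' y‖ < ‖f' x‖ + 1 :=
        hc'.norm.eventually_lt_const (by linarith)
      refine ⟨v ∩ {y | ‖f' y‖ < ‖f' x‖ + 1}, inter_mem hv hb, ‖f' x‖ + 1, by
        linarith [norm_nonneg (f' x)], ?_⟩
      rintro y ⟨⟨hyv, hyb⟩, hyΩ⟩
      have hd : HasFDerivAt u (f' y) y :=
        (hf' y hyv).hasFDerivAt (mem_of_superset (hΩ.mem_nhds hyΩ) subset_closure)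
      rw [hd.fderiv]
      exact le_of_lt hyb
  obtain ⟨M, h1, h⟩ := key
  exact ⟨M, h1, fun x hx => h x ⟨subset_closure hx, hx⟩⟩

open Filter Topology Metric in
lemma abs_le_dist {n : ℕ} {Ω : Set (Euc n)} (hΩ : IsOpen Ω) {u : Euc n → ℝ}
    (hu : ContinuousOn u (closure Ω)) (hd : ∀ x ∈ Ω, DifferentiableAt ℝ u x)
    {M : ℝ} (hM : ∀ x ∈ Ω, ‖fderiv ℝ u x‖ ≤ M)
    (h0 : ∀ x ∈ frontier Ω, u x = 0) (hne : (Ωᶜ).Nonempty) {x : Euc n} (hx : x ∈ Ω) :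
    |u x| ≤ M * infDist x Ωᶜ := by
  obtain ⟨z, hz, hxz⟩ := hΩ.isClosed_compl.exists_infDist_eq_dist hne x
  have hball : ball x (infDist x Ωᶜ) ⊆ Ω := by
    intro y hy
    by_contra hyn
    have : infDist x Ωᶜ ≤ dist x y := infDist_le_dist_of_mem hyn
    rw [mem_ball, dist_comm] at hy
    linarith
  have hpos : 0 < dist x z := dist_pos.2 (fun h => hz (h ▸ hx))
  have hzc : z ∈ closure (ball x (infDist x Ωᶜ)) := by
    rw [closure_ball _ (by rw [hxz]; exact hpos.ne'), mem_closedBall, hxz, dist_comm]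
  have hzf : z ∈ frontier Ω := by
    rw [hΩ.frontier_eq]
    exact ⟨closure_mono hball hzc, hz⟩
  have hcont : ContinuousWithinAt u (ball x (infDist x Ωᶜ)) z :=
    (hu z (closure_mono hball hzc)).mono (hball.trans subset_closure)
  have hle : ∀ y ∈ ball x (infDist x Ωᶜ), ‖u x - u y‖ ≤ M * ‖x - y‖ := by
    intro y hy
    refine (convex_ball x (infDist x Ωᶜ)).norm_image_sub_le_of_norm_fderiv_le
      (𝕜 := ℝ) (fun w hw => hd w (hball hw)) (fun w hw => hM w (hball hw)) hy ?_
    exact mem_ball_self (by rw [hxz]; exact hpos)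
  have : (𝓝[ball x (infDist x Ωᶜ)] z).NeBot := mem_closure_iff_nhdsWithin_neBot.1 hzc
  have hlim := le_of_tendsto_of_tendsto (b := 𝓝[ball x (infDist x Ωᶜ)] z)
    ((tendsto_const_nhds (x := u x)).sub hcont).norm
    ((((continuous_const.sub continuous_id).norm.const_mul M).tendsto z).mono_left
      nhdsWithin_le_nhds : Tendsto (fun y => M * ‖x - y‖) _ _)
    (eventually_nhdsWithin_of_forall hle)
  have hlim : ‖u x - u z‖ ≤ M * ‖x - z‖ := hlim
  rw [h0 z hzf, sub_zero, ← dist_eq_norm, ← hxz] at hlim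
  exact hlim

open Filter Topology Metric in
lemma ext_lipschitz {n : ℕ} {Ω : Set (Euc n)} (hΩ : IsOpen Ω) {u : Euc n → ℝ}
    (hu : ContinuousOn u (closure Ω)) (hd : ∀ x ∈ Ω, DifferentiableAt ℝ u x)
    {M : ℝ} (hM0 : 0 ≤ M) (hM : ∀ x ∈ Ω, ‖fderiv ℝ u x‖ ≤ M)
    (h0 : ∀ x ∈ frontier Ω, u x = 0) (hne : (Ωᶜ).Nonempty) :
    LipschitzWith (Real.toNNReal M) (Ω.indicator u) := by
  have hB : ∀ x ∈ Ω, ∀ y ∉ Ω, |u x| ≤ M * dist x y := fun x hx y hy =>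
    (abs_le_dist hΩ hu hd hM h0 hne hx).trans
      (mul_le_mul_of_nonneg_left (infDist_le_dist_of_mem hy) hM0)
  refine LipschitzWith.of_dist_le_mul fun x y => ?_
  rw [Real.coe_toNNReal _ hM0, Real.dist_eq]
  by_cases hx : x ∈ Ω <;> by_cases hy : y ∈ Ω
  · rw [indicator_of_mem hx, indicator_of_mem hy]
    by_cases hs : segment ℝ x y ⊆ Ω
    · have := (convex_segment (𝕜 := ℝ) x y).norm_image_sub_le_of_norm_fderiv_le
        (𝕜 := ℝ) (fun w hw => hd w (hs hw)) (fun w hw => hM w (hs hw))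
        (right_mem_segment ℝ x y) (left_mem_segment ℝ x y)
      rwa [← dist_eq_norm x y] at this
    · obtain ⟨w, hw, hwΩ⟩ := not_subset.1 hs
      have h1 := hB x hx w hwΩ
      have h2 := hB y hy w hwΩ
      have h3 := dist_add_dist_of_mem_segment hw
      have h4 := abs_sub (u x) (u y)
      rw [dist_comm y w] at h2
      rw [← h3, mul_add]
      linarith
  · rw [indicator_of_mem hx, indicator_of_notMem hy, sub_zero]
    exact hB x hx y hy
  · rw [indicator_of_notMem hx, indicator_of_mem hy, zero_sub, abs_neg, dist_comm]
    exact hB y hy x hx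
  · rw [indicator_of_notMem hx, indicator_of_notMem hy]
    simp; positivity

/-- The nonlinearity. -/
def gg (p s : ℝ) : ℝ := s * |s| ^ (p - 1)

lemma gg_lip {p : ℝ} (hp : 1 < p) (R : ℝ) :
    ∃ C : ℝ, 0 ≤ C ∧ ∀ a b : ℝ, |a| ≤ R → |b| ≤ R → |gg p a - gg p b| ≤ C * |a - b| := by
  have hg : ∀ s, gg p s = (max s 0) ^ p - (max (-s) 0) ^ p := by
    intro s
    have hp0 : p ≠ 0 := by linarith
    unfold gg
    rcases lt_trichotomy s 0 with h | h | h
    · rw [max_eq_right h.le, max_eq_left (by linarith), Real.zero_rpow hp0, abs_of_neg h,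
        Real.rpow_sub_one (by linarith)]
      have : s ≠ 0 := h.ne
      have e : s * ((-s) ^ p / -s) = -(-s) ^ p := by
        rw [div_neg, mul_neg, mul_div_cancel₀ _ this]
      rw [e]; ring
    · subst h; simp
    · rw [max_eq_left h.le, max_eq_right (by linarith), Real.zero_rpow hp0, abs_of_pos h,
        Real.rpow_sub_one (by linarith)]
      field_simp
      ring
  have hc : ContDiff ℝ 1 (fun x : ℝ => x ^ p) :=
    mod_cast Real.contDiff_rpow_const_of_le (n := 1) (by simpa using hp.le)
  obtain ⟨K, hK⟩ := (hc.contDiffOn (s := Icc (0:ℝ) R)).exists_lipschitzOnWith (by simp)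
    (convex_Icc _ _) isCompact_Icc
  refine ⟨K + K, by positivity, fun a b ha hb => ?_⟩
  have hR : 0 ≤ R := (abs_nonneg a).trans ha
  have hm : ∀ s, |s| ≤ R → max s 0 ∈ Icc (0:ℝ) R := fun s hs =>
    ⟨le_max_right _ _, max_le ((le_abs_self s).trans hs) hR⟩
  have h1 := hK.dist_le_mul _ (hm a ha) _ (hm b hb)
  have h2 := hK.dist_le_mul _ (hm (-a) (by rwa [abs_neg])) _ (hm (-b) (by rwa [abs_neg]))
  simp only [Real.dist_eq] at h1 h2
  have e1 : |max a 0 - max b 0| ≤ |a - b| := abs_max_sub_max_le_abs a b 0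
  have e2 : |max (-a) 0 - max (-b) 0| ≤ |a - b| := by
    refine (abs_max_sub_max_le_abs (-a) (-b) 0).trans (le_of_eq ?_)
    rw [← abs_neg]; congr 1; ring
  have hK0 : (0:ℝ) ≤ K := K.2
  have h1' := h1.trans (mul_le_mul_of_nonneg_left e1 hK0)
  have h2' := h2.trans (mul_le_mul_of_nonneg_left e2 hK0)
  rw [hg, hg, add_mul]
  refine le_trans (le_of_eq ?_) ((abs_sub _ _).trans (add_le_add h1' h2'))
  congr 1; ring

lemma GG_ineq {p : ℝ} (hp : 1 < p) (R : ℝ) :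
    ∃ C : ℝ, 0 ≤ C ∧ ∀ a b : ℝ, |a| ≤ R → |b| ≤ R →
      |b| ^ (p + 1) / (p + 1) - |a| ^ (p + 1) / (p + 1) ≤ gg p a * (b - a) + C * (b - a) ^ 2 := by
  obtain ⟨C, hC, hL⟩ := gg_lip hp R
  refine ⟨C, hC, fun a b ha hb => ?_⟩
  have hder : ∀ x, HasDerivAt (fun x : ℝ => |x| ^ (p + 1) / (p + 1)) (gg p x) x := by
    intro x
    have h := (hasDerivAt_abs_rpow x (p := p + 1) (by linarith)).div_const (p + 1)
    refine HasDerivAt.congr_deriv h ?_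
    unfold gg
    have : p + 1 ≠ 0 := by linarith
    rw [show p + 1 - 2 = p - 1 by ring]
    field_simp
  have hf : ∀ x ∈ Icc (-R) R ∩ uIcc a b,
      HasDerivWithinAt (fun x : ℝ => |x| ^ (p + 1) / (p + 1) - gg p a * x) (gg p x - gg p a)
      (Icc (-R) R ∩ uIcc a b) x := by
    intro x _
    have h3 : HasDerivAt (fun x : ℝ => gg p a * x) (gg p a) x := by
      simpa using (hasDerivAt_id x).const_mul (gg p a)
    exact ((hder x).fun_sub h3).hasDerivWithinAt
  have hb' : ∀ x ∈ Icc (-R) R ∩ uIcc a b, ‖gg p x - gg p a‖ ≤ C * |b - a| := by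
    rintro x ⟨hx, hx'⟩
    refine (hL x a (abs_le.2 hx) ha).trans (mul_le_mul_of_nonneg_left ?_ hC)
    exact abs_sub_left_of_mem_uIcc hx'
  have := ((convex_Icc (-R) R).inter (convex_uIcc a b)).norm_image_sub_le_of_norm_hasDerivWithin_le
    hf hb' (x := a) (y := b) ⟨abs_le.1 ha, left_mem_uIcc⟩ ⟨abs_le.1 hb, right_mem_uIcc⟩
  have h2 := (le_abs_self _).trans this
  rw [Real.norm_eq_abs, mul_assoc, abs_mul_abs_self] at h2
  nlinarith [h2]

lemma gg_cont {p : ℝ} (hp : 1 < p) : Continuous (gg p) := by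
  unfold gg
  exact continuous_id.mul (continuous_abs.rpow_const fun x => Or.inr (by linarith))

open Filter Topology Metric Function in
open scoped Manifold ContDiff in
lemma weak_form {n : ℕ} {Ω : Set (Euc n)} (hΩ : IsOpen Ω) {u : Euc n → ℝ}
    (hu : ContDiffOn ℝ 2 u Ω) {p : ℝ}
    (heq : ∀ x ∈ Ω, lap u x + gg p (u x) = 0)
    {ψ : Euc n → ℝ} {C : NNReal} (hψ : LipschitzWith C ψ) {K : Set (Euc n)} (hK : IsCompact K)
    (hKΩ : K ⊆ Ω) (hsupp : ∀ x ∉ K, ψ x = 0) :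
    ∑ i, ∫ x, Ω.indicator (pd u i) x * lineDeriv ℝ ψ x (EuclideanSpace.single i 1)
      = ∫ x, gg p (Ω.indicator u x) * ψ x := by
  have hts : tsupport ψ ⊆ K := closure_minimal
    (fun x hx => by_contra fun h => hx (hsupp x h)) hK.isClosed
  have hψc : HasCompactSupport ψ := hK.of_isClosed_subset (isClosed_tsupport ψ) hts
  obtain ⟨L, hL, hKL, hLΩ⟩ := exists_compact_between hK hΩ hKΩ
  obtain ⟨η, hη, -, hηs, hη1⟩ := exists_contMDiff_support_eq_eq_one_iff (n := 1)
    (𝓘(ℝ, Euc n)) (isOpen_interior (s := L)) (isClosed_tsupport ψ) (hts.trans hKL)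
  have hη' : ContDiff ℝ 1 η := hη.contDiff
  have hηt : tsupport η ⊆ L := by
    rw [tsupport, hηs]; exact closure_minimal interior_subset hL.isClosed
  have hpd : ∀ i, ContDiffOn ℝ 1 (pd u i) Ω := by
    intro i
    have h1 : ContDiffOn ℝ 1 (fderiv ℝ u) Ω := hu.fderiv_of_isOpen hΩ (by norm_num)
    exact h1.clm_apply contDiffOn_const
  have hfC : ∀ i, ContDiff ℝ 1 (fun x => η x * pd u i x) := by
    intro i
    rw [contDiff_iff_contDiffAt]
    intro x
    by_cases hx : x ∈ tsupport η
    swap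
    · have hev : η =ᶠ[𝓝 x] 0 := notMem_tsupport_iff_eventuallyEq.1 hx
      have h0 : ContDiffAt ℝ 1 (fun _ : Euc n => (0 : ℝ)) x := contDiffAt_const
      refine h0.congr_of_eventuallyEq ?_
      filter_upwards [hev] with y hy
      simp [hy]
    have hxΩ : x ∈ Ω := hLΩ (hηt hx)
    exact hη'.contDiffAt.mul ((hpd i).contDiffAt (hΩ.mem_nhds hxΩ))
  have hfc : ∀ i, HasCompactSupport (fun x => η x * pd u i x) := fun i =>
    hL.of_isClosed_subset (isClosed_tsupport _) (tsupport_mul_subset_left.trans hηt)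
  -- integration by parts
  have hibp : ∀ i, ∫ x, pd (fun y => pd u i y) i x * ψ x =
      -∫ x, Ω.indicator (pd u i) x * lineDeriv ℝ ψ x (EuclideanSpace.single i 1) := by
    intro i
    obtain ⟨D, hD⟩ := ContDiff.lipschitzWith_of_hasCompactSupport (hfc i) (hfC i) (by simp)
    have h := LipschitzWith.integral_lineDeriv_mul_eq (μ := volume) hD hψ hψc (EuclideanSpace.single i 1)
    rw [← integral_neg]
    refine Eq.trans (integral_congr_ae (.of_forall fun x => ?_))
      (h.trans (integral_congr_ae (.of_forall fun x => ?_)))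
    · by_cases hx : ψ x = 0
      · simp [hx]
      · have hev : (fun x => η x * pd u i x) =ᶠ[𝓝 x] pd u i := by
          have : support ψ ∈ 𝓝 x := hψ.continuous.isOpen_support.mem_nhds hx
          filter_upwards [this] with y hy
          rw [(hη1 y).1 (subset_tsupport _ hy), one_mul]
        have hxΩ : x ∈ Ω := hKΩ (hts (subset_tsupport _ hx))
        have hdiff : DifferentiableAt ℝ (pd u i) x :=
          ((hpd i).contDiffAt (hΩ.mem_nhds hxΩ)).differentiableAt (by simp)
        simp only
        rw [hev.lineDeriv_eq, hdiff.lineDeriv_eq_fderiv]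
        rfl
    · simp only [lineDeriv_neg]
      by_cases hx : x ∈ tsupport ψ
      · rw [(hη1 x).1 hx, indicator_of_mem (hKΩ (hts hx))]
        ring
      · have hev : ψ =ᶠ[𝓝 x] 0 := notMem_tsupport_iff_eventuallyEq.1 hx
        have : lineDeriv ℝ ψ x (EuclideanSpace.single i 1) = 0 := by
          rw [hev.lineDeriv_eq]; simp [lineDeriv]
        simp [this]
  have hint : ∀ i, Integrable (fun x => pd (fun y => pd u i y) i x * ψ x) := by
    intro i
    have hc : Continuous (fun x => fderiv ℝ (fun x => η x * pd u i x) x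
        (EuclideanSpace.single i 1) * ψ x) :=
      (((hfC i).continuous_fderiv (by simp)).clm_apply continuous_const).mul hψ.continuous
    have := hc.integrable_of_hasCompactSupport (μ := volume) hψc.mul_left
    refine this.congr (.of_forall fun x => ?_)
    by_cases hx : ψ x = 0
    · simp [hx]
    · have hev : (fun x => η x * pd u i x) =ᶠ[𝓝 x] pd u i := by
        have : support ψ ∈ 𝓝 x := hψ.continuous.isOpen_support.mem_nhds hx
        filter_upwards [this] with y hy
        rw [(hη1 y).1 (subset_tsupport _ hy), one_mul]
      simp only
      rw [hev.fderiv_eq]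
      rfl
  have hsum : ∑ i, ∫ x, pd (fun y => pd u i y) i x * ψ x = -∫ x, gg p (Ω.indicator u x) * ψ x := by
    rw [← integral_finsetSum _ (fun i _ => hint i), ← integral_neg]
    refine integral_congr_ae (.of_forall fun x => ?_)
    simp only
    rw [← Finset.sum_mul]
    by_cases hx : x ∈ Ω
    · have h := heq x hx
      unfold lap at h
      rw [indicator_of_mem hx, eq_neg_of_add_eq_zero_left h, neg_mul]
    · rw [hsupp x (fun h => hx (hKΩ h))]; simp
  simp only [hibp, Finset.sum_neg_distrib, neg_inj] at hsum
  exact hsum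

/-- Truncation of `v` by the distance to the complement of `Ω`. -/
def trunc {n : ℕ} (Ω : Set (Euc n)) (v : Euc n → ℝ) (M ε : ℝ) (x : Euc n) : ℝ :=
  max (min (v x) (max (2 * M * Metric.infDist x Ωᶜ - ε) 0))
    (-max (2 * M * Metric.infDist x Ωᶜ - ε) 0)

lemma trunc_lipschitz {n : ℕ} {Ω : Set (Euc n)} {v : Euc n → ℝ} {M : ℝ} (hM : 0 ≤ M) (ε : ℝ)
    (hv : LipschitzWith (Real.toNNReal M) v) :
    LipschitzWith (Real.toNNReal (2 * M)) (trunc Ω v M ε) := by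
  have h1 : LipschitzWith (Real.toNNReal (2 * M))
      (fun x => 2 * M * Metric.infDist x Ωᶜ - ε) := by
    refine LipschitzWith.of_dist_le_mul fun x y => ?_
    rw [Real.coe_toNNReal _ (by positivity), Real.dist_eq]
    have := (Metric.lipschitz_infDist_pt Ωᶜ).dist_le_mul x y
    rw [Real.dist_eq, NNReal.coe_one, one_mul] at this
    rw [show 2 * M * Metric.infDist x Ωᶜ - ε - (2 * M * Metric.infDist y Ωᶜ - ε)
      = 2 * M * (Metric.infDist x Ωᶜ - Metric.infDist y Ωᶜ) by ring, abs_mul,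
      abs_of_nonneg (by positivity : 0 ≤ 2 * M)]
    exact mul_le_mul_of_nonneg_left this (by positivity)
  have h2 := h1.max_const 0
  have hv' : LipschitzWith (Real.toNNReal (2 * M)) v :=
    hv.weaken (Real.toNNReal_le_toNNReal (by linarith))
  have h3 := (hv'.min h2).max h2.neg
  rw [max_self, max_self] at h3
  exact h3

lemma trunc_abs_le {n : ℕ} (Ω : Set (Euc n)) (v : Euc n → ℝ) (M ε : ℝ) (x : Euc n) :
    |trunc Ω v M ε x| ≤ |v x| := by
  unfold trunc
  generalize hc : max (2 * M * Metric.infDist x Ωᶜ - ε) 0 = c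
  have hc0 : 0 ≤ c := hc ▸ le_max_right _ _
  rw [abs_le]
  refine ⟨?_, max_le ((min_le_left _ _).trans (le_abs_self _)) (by linarith [abs_nonneg (v x)])⟩
  refine le_max_of_le_left (le_min (neg_abs_le _) (by linarith [abs_nonneg (v x)]))

lemma trunc_eq_zero {n : ℕ} {Ω : Set (Euc n)} {v : Euc n → ℝ} {M ε : ℝ} {x : Euc n}
    (h : 2 * M * Metric.infDist x Ωᶜ ≤ ε) : trunc Ω v M ε x = 0 := by
  unfold trunc
  rw [max_eq_right (a := 2 * M * Metric.infDist x Ωᶜ - ε) (by linarith)]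
  simp

lemma trunc_eq_self {n : ℕ} {Ω : Set (Euc n)} {v : Euc n → ℝ} {M ε : ℝ} {x : Euc n}
    (hv : |v x| ≤ M * Metric.infDist x Ωᶜ) (h : ε ≤ M * Metric.infDist x Ωᶜ) :
    trunc Ω v M ε x = v x := by
  unfold trunc
  have h1 : |v x| ≤ max (2 * M * Metric.infDist x Ωᶜ - ε) 0 :=
    le_max_of_le_left (by linarith)
  rw [abs_le] at h1
  rw [min_eq_left h1.2, max_eq_left h1.1]

open Filter Topology Metric in
lemma weak_dil {n : ℕ} {Ω : Set (Euc n)} (hΩ : IsOpen Ω) (hΩb : Bornology.IsBounded Ω)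
    (hstar : StarConvex ℝ (0 : Euc n) Ω) {u : Euc n → ℝ}
    (hu : ContDiffOn ℝ 2 u Ω) {p : ℝ} (hp : 1 < p)
    (heq : ∀ x ∈ Ω, lap u x + gg p (u x) = 0) (hne : (Ωᶜ).Nonempty)
    {M : ℝ} (hM1 : 1 ≤ M) (hM : ∀ x ∈ Ω, ‖fderiv ℝ u x‖ ≤ M)
    (hlip : LipschitzWith (Real.toNNReal M) (Ω.indicator u))
    (hdist : ∀ x ∈ Ω, |u x| ≤ M * infDist x Ωᶜ) {B : ℝ} (hB : ∀ x, |Ω.indicator u x| ≤ B)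
    {l : ℝ} (hl : 1 ≤ l) :
    ∑ i, ∫ x, Ω.indicator (pd u i) x * (l * Ω.indicator (pd u i) (l • x))
      = ∫ x, gg p (Ω.indicator u x) * Ω.indicator u (l • x) := by
  have hl0 : 0 < l := by linarith
  have hM0 : 0 < M := by linarith
  set U := Ω.indicator u with hU
  have hg : Continuous (gg p) := gg_cont hp
  let ε : ℕ → ℝ := fun k => 1 / ((k : ℝ) + 1)
  have hε0 : ∀ k, 0 < ε k := fun k => by positivity
  have hεlim : Tendsto ε atTop (𝓝 0) := tendsto_one_div_add_atTop_nhds_zero_nat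
  let ψ : ℕ → Euc n → ℝ := fun k x => trunc Ω U M (ε k) (l • x)
  have hψl : ∀ k, LipschitzWith (Real.toNNReal (2 * M) * ‖l‖₊) (ψ k) := fun k =>
    (trunc_lipschitz hM0.le (ε k) hlip).comp (lipschitzWith_smul l)
  have hUd : ∀ x, |U x| ≤ M * infDist x Ωᶜ := by
    intro x
    by_cases hx : x ∈ Ω
    · rw [hU, indicator_of_mem hx]; exact hdist x hx
    · rw [hU, indicator_of_notMem hx, abs_zero]; exact mul_nonneg hM0.le infDist_nonneg
  -- supports
  have hweak : ∀ k, ∑ i, ∫ x, Ω.indicator (pd u i) x *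
      lineDeriv ℝ (ψ k) x (EuclideanSpace.single i 1) = ∫ x, gg p (U x) * ψ k x := by
    intro k
    let K0 : Set (Euc n) := closure Ω ∩ {x | ε k ≤ 2 * M * infDist x Ωᶜ}
    have hK0 : IsCompact K0 := by
      refine hΩb.isCompact_closure.inter_right (isClosed_le continuous_const ?_)
      exact (continuous_infDist_pt _).const_mul _
    have hK0Ω : K0 ⊆ Ω := by
      rintro x ⟨-, hx⟩
      by_contra hxn
      have : infDist x Ωᶜ = 0 := infDist_zero_of_mem hxn
      simp only [mem_ofPred_eq, this, mul_zero] at hx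
      exact absurd hx (not_le.2 (hε0 k))
    have hK : IsCompact ((fun y : Euc n => l⁻¹ • y) '' K0) :=
      hK0.image (continuous_const_smul _)
    refine weak_form hΩ hu heq (hψl k) hK ?_ ?_
    · rintro _ ⟨y, hy, rfl⟩
      exact hstar.smul_mem (hK0Ω hy) (by positivity) (inv_le_one_of_one_le₀ hl)
    · intro x hx
      by_contra hne0
      apply hx
      refine ⟨l • x, ⟨?_, ?_⟩, by simp [smul_smul, hl0.ne']⟩
      · by_contra hcl
        have hn : l • x ∉ Ω := fun h => hcl (subset_closure h)
        have h1 := trunc_abs_le Ω U M (ε k) (l • x)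
        rw [hU, indicator_of_notMem hn, abs_zero] at h1
        exact hne0 (abs_eq_zero.1 (le_antisymm h1 (abs_nonneg _)))
      · by_contra hlt
        exact hne0 (trunc_eq_zero (not_le.1 hlt).le)
  -- pointwise limits
  have hin : ∀ x ∈ Ω, ∀ᶠ k in atTop, ∀ᶠ y in 𝓝 x, trunc Ω U M (ε k) y = U y := by
    intro x hx
    have hpos : 0 < infDist x Ωᶜ :=
      (hΩ.isClosed_compl.notMem_iff_infDist_pos hne).1 (fun h => h hx)
    have h1 : ∀ᶠ k in atTop, ε k < M * (infDist x Ωᶜ / 2) :=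
      hεlim.eventually_lt_const (by positivity)
    have h2 : ∀ᶠ y in 𝓝 x, infDist x Ωᶜ / 2 < infDist y Ωᶜ :=
      (continuous_infDist_pt Ωᶜ).continuousAt.eventually_const_lt (by linarith)
    filter_upwards [h1] with k hk
    filter_upwards [h2] with y hy
    exact trunc_eq_self (hUd y) (hk.le.trans (mul_le_mul_of_nonneg_left hy.le hM0.le))
  have hout : ∀ x ∉ Ω, ∀ k, ∀ᶠ y in 𝓝 x, trunc Ω U M (ε k) y = 0 := by
    intro x hx k
    have h0 : infDist x Ωᶜ = 0 := infDist_zero_of_mem hx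
    have h2 : ∀ᶠ y in 𝓝 x, 2 * M * infDist y Ωᶜ < ε k :=
      ((continuous_infDist_pt Ωᶜ).const_mul (2 * M)).continuousAt.eventually_lt_const
        (by simp only [h0, mul_zero]; exact hε0 k)
    filter_upwards [h2] with y hy
    exact trunc_eq_zero hy.le
  have hsm : ∀ x : Euc n, Tendsto (fun y : Euc n => l • y) (𝓝 x) (𝓝 (l • x)) := fun x =>
    (continuous_const_smul l).continuousAt
  have hlimψ : ∀ x, Tendsto (fun k => ψ k x) atTop (𝓝 (U (l • x))) := by
    intro x
    by_cases hx : l • x ∈ Ω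
    · refine tendsto_const_nhds.congr' ?_
      filter_upwards [hin _ hx] with k hk
      exact hk.self_of_nhds.symm
    · refine tendsto_const_nhds.congr' (.of_forall fun k => ?_)
      rw [hU, indicator_of_notMem hx]
      exact (hout _ hx k).self_of_nhds.symm
  have hlimd : ∀ i x, Tendsto (fun k => lineDeriv ℝ (ψ k) x (EuclideanSpace.single i 1)) atTop
      (𝓝 (l * Ω.indicator (pd u i) (l • x))) := by
    intro i x
    by_cases hx : l • x ∈ Ω
    · refine tendsto_const_nhds.congr' ?_
      filter_upwards [hin _ hx] with k hk
      have h1 : ψ k =ᶠ[𝓝 x] fun y => u (l • y) := by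
        filter_upwards [(hsm x).eventually hk, (hsm x).eventually (hΩ.mem_nhds hx)] with y hy hyΩ
        simp only [ψ]
        rw [hy, hU, indicator_of_mem hyΩ]
      have hd : DifferentiableAt ℝ u (l • x) :=
        (hu.contDiffAt (hΩ.mem_nhds hx)).differentiableAt (by simp)
      have hd2 : HasFDerivAt (fun y => u (l • y))
          ((fderiv ℝ u (l • x)).comp (l • ContinuousLinearMap.id ℝ (Euc n))) x :=
        hd.hasFDerivAt.comp x ((hasFDerivAt_id x).const_smul l)
      rw [h1.lineDeriv_eq, hd2.differentiableAt.lineDeriv_eq_fderiv, hd2.fderiv,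
        indicator_of_mem hx]
      simp [pd]
    · refine tendsto_const_nhds.congr' (.of_forall fun k => ?_)
      have h1 : ψ k =ᶠ[𝓝 x] fun _ => 0 := (hsm x).eventually (hout _ hx k)
      simp only
      rw [h1.lineDeriv_eq, indicator_of_notMem hx, mul_zero]
      simp [lineDeriv]
  have hΩfin : volume Ω < ⊤ := hΩb.measure_lt_top
  have hbi : ∀ c : ℝ, Integrable (Ω.indicator fun _ => c) := fun c =>
    (integrable_indicator_iff hΩ.measurableSet).2 (integrableOn_const hΩfin.ne)
  have hDm : ∀ i, Measurable (Ω.indicator (pd u i)) := fun i =>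
    (measurable_fderiv_apply_const ℝ u _).indicator hΩ.measurableSet
  have hL : Tendsto (fun k => ∑ i, ∫ x, Ω.indicator (pd u i) x *
      lineDeriv ℝ (ψ k) x (EuclideanSpace.single i 1)) atTop
      (𝓝 (∑ i, ∫ x, Ω.indicator (pd u i) x * (l * Ω.indicator (pd u i) (l • x)))) := by
    refine tendsto_finsetSum _ fun i _ => ?_
    refine tendsto_integral_of_dominated_convergence
      (Ω.indicator fun _ => M * (2 * M * l)) ?_ (hbi _) ?_ ?_
    · intro k
      exact ((hDm i).mul (measurable_lineDeriv (hψl k).continuous)).aestronglyMeasurable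
    · intro k
      refine .of_forall fun x => ?_
      by_cases hx : x ∈ Ω
      · rw [indicator_of_mem hx, indicator_of_mem hx, norm_mul]
        refine mul_le_mul ?_ ?_ (norm_nonneg _) hM0.le
        · refine ((fderiv ℝ u x).le_opNorm _).trans ?_
          simpa using hM x hx
        · refine (norm_lineDeriv_le_of_lipschitz ℝ (hψl k)).trans (le_of_eq ?_)
          simp [abs_of_pos hl0, hM0.le]
      · rw [indicator_of_notMem hx, indicator_of_notMem hx]; simp
    · exact .of_forall fun x => (hlimd i x).const_mul _
  have hR : Tendsto (fun k => ∫ x, gg p (U x) * ψ k x) atTop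
      (𝓝 (∫ x, gg p (U x) * U (l • x))) := by
    obtain ⟨G, hG⟩ := (isCompact_Icc (a := -B) (b := B)).exists_bound_of_continuousOn hg.continuousOn
    refine tendsto_integral_of_dominated_convergence
      (Ω.indicator fun _ => G * B) ?_ (hbi _) ?_ ?_
    · intro k
      exact ((hg.comp hlip.continuous).mul (hψl k).continuous).aestronglyMeasurable
    · intro k
      refine .of_forall fun x => ?_
      by_cases hx : x ∈ Ω
      · rw [indicator_of_mem hx, norm_mul]
        have h1 := hG (U x) (abs_le.1 (hB x))
        exact mul_le_mul h1 ((trunc_abs_le _ _ _ _ _).trans (hB _)) (norm_nonneg _)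
          ((norm_nonneg _).trans h1)
      · rw [indicator_of_notMem hx, hU, indicator_of_notMem hx]; simp [gg]
    · exact .of_forall fun x => (hlimψ x).const_mul _
  simp only [hweak] at hL
  exact tendsto_nhds_unique hL hR

open Filter Topology in
/-- One-sided derivative comparison used to conclude. -/
lemma final_calc {n : ℕ} {p A C : ℝ}
    (h : ∀ l : ℝ, 1 ≤ l → ((l ^ n)⁻¹ - 1) / (p + 1) * A ≤
      1 / 2 * (l ^ 2 * (l ^ n)⁻¹ * A) - 1 / 2 * A + C * (l - 1) ^ 2) :
    0 ≤ 1 / 2 * (2 - n) * A + n / (p + 1) * A := by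
  let f : ℝ → ℝ := fun l => 1 / 2 * (l ^ 2 - l ^ n) * A + C * (l - 1) ^ 2 * l ^ n
    - (1 - l ^ n) / (p + 1) * A
  have hf1 : f 1 = 0 := by simp [f]
  have hf0 : ∀ l, 1 ≤ l → 0 ≤ f l := by
    intro l hl
    have hln : 0 < l ^ n := by positivity
    have h1 := mul_le_mul_of_nonneg_right (h l hl) hln.le
    have e1 : ((l ^ n)⁻¹ - 1) / (p + 1) * A * l ^ n = (1 - l ^ n) / (p + 1) * A := by
      have : (l ^ n)⁻¹ * l ^ n = 1 := inv_mul_cancel₀ hln.ne'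
      linear_combination A / (p + 1) * this
    have e2 : (1 / 2 * (l ^ 2 * (l ^ n)⁻¹ * A) - 1 / 2 * A + C * (l - 1) ^ 2) * l ^ n
        = 1 / 2 * (l ^ 2 - l ^ n) * A + C * (l - 1) ^ 2 * l ^ n := by
      have : (l ^ n)⁻¹ * l ^ n = 1 := inv_mul_cancel₀ hln.ne'
      linear_combination 1 / 2 * l ^ 2 * A * this
    rw [e1, e2] at h1
    simp only [f]
    linarith
  have hp1 : HasDerivAt (fun l : ℝ => l ^ n) (n : ℝ) 1 := by
    simpa using hasDerivAt_pow n (1 : ℝ)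
  have hp2 : HasDerivAt (fun l : ℝ => l ^ 2) 2 1 := by
    simpa using hasDerivAt_pow 2 (1 : ℝ)
  have hp3 : HasDerivAt (fun l : ℝ => (l - 1) ^ 2) 0 1 := by
    have h3 := ((hasDerivAt_id' (1 : ℝ)).sub_const 1).fun_pow 2
    exact h3.congr_deriv (by simp)
  have hd : HasDerivAt f (1 / 2 * (2 - n) * A + n / (p + 1) * A) 1 := by
    have := ((((hp2.fun_sub hp1).const_mul (1 / 2)).mul_const A).fun_add
      ((hp3.const_mul C).fun_mul hp1)).fun_sub
      (((hp1.const_sub 1).div_const (p + 1)).mul_const A)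
    refine this.congr_deriv ?_
    simp
    ring
  have hs := (hasDerivWithinAt_iff_tendsto_slope' (by simp)).1 (hd.hasDerivWithinAt (s := Ioi 1))
  refine ge_of_tendsto hs (eventually_nhdsWithin_of_forall fun l hl => ?_)
  have hl' : (1 : ℝ) < l := hl
  rw [slope_def_field, hf1, sub_zero]
  exact div_nonneg (hf0 l hl'.le) (by linarith)

open Filter Topology Metric in
lemma main_ineq {n : ℕ} {Ω : Set (Euc n)} (hΩ : IsOpen Ω) (hΩb : Bornology.IsBounded Ω)
    (hstar : StarConvex ℝ (0 : Euc n) Ω) {u : Euc n → ℝ}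
    (hu : ContDiffOn ℝ 2 u Ω) (hu1 : ContDiffOn ℝ 1 u (closure Ω)) {p : ℝ} (hp : 1 < p)
    (heq : ∀ x ∈ Ω, lap u x + gg p (u x) = 0)
    (h0 : ∀ x ∈ frontier Ω, u x = 0) (hne : (Ωᶜ).Nonempty) (hex : ∃ x ∈ Ω, u x ≠ 0) :
    ∃ A C : ℝ, 0 < A ∧ ∀ l : ℝ, 1 ≤ l → ((l ^ n)⁻¹ - 1) / (p + 1) * A ≤
      1 / 2 * (l ^ 2 * (l ^ n)⁻¹ * A) - 1 / 2 * A + C * (l - 1) ^ 2 := by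
  obtain ⟨M, hM1, hM⟩ := grad_bdd hΩ hΩb hu1
  have hM0 : 0 < M := by linarith
  have hd : ∀ x ∈ Ω, DifferentiableAt ℝ u x := fun x hx =>
    (hu.contDiffAt (hΩ.mem_nhds hx)).differentiableAt (by simp)
  have hlip := ext_lipschitz hΩ hu1.continuousOn hd hM0.le hM h0 hne
  have hdist : ∀ x ∈ Ω, |u x| ≤ M * infDist x Ωᶜ := fun x hx =>
    abs_le_dist hΩ hu1.continuousOn hd hM h0 hne hx
  have hcs : ∀ F : Euc n → ℝ, (∀ x ∉ Ω, F x = 0) → HasCompactSupport F := fun F hF =>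
    HasCompactSupport.intro hΩb.isCompact_closure (fun x hx => hF x (fun h => hx (subset_closure h)))
  have hi : ∀ F : Euc n → ℝ, Continuous F → (∀ x ∉ Ω, F x = 0) → Integrable F := fun F hF hF0 =>
    hF.integrable_of_hasCompactSupport (hcs F hF0)
  have hU0 : ∀ x ∉ Ω, Ω.indicator u x = 0 := fun x hx => indicator_of_notMem hx u
  have hUc : Continuous (Ω.indicator u) := hlip.continuous
  obtain ⟨B, hB⟩ := (hcs _ hU0).exists_bound_of_continuous hUc
  have hw := fun (l : ℝ) (hl : 1 ≤ l) =>
    weak_dil hΩ hΩb hstar hu hp heq hne hM1 hM hlip hdist hB hl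
  set U := Ω.indicator u with hU
  have hg : Continuous (gg p) := gg_cont hp
  have hgU : ∀ s, gg p s * s = |s| ^ (p + 1) := by
    intro s
    unfold gg
    by_cases hs : s = 0
    · subst hs; simp [Real.zero_rpow (by linarith : p + 1 ≠ 0)]
    · rw [show p + 1 = (p - 1) + 2 by ring, Real.rpow_add (abs_pos.2 hs)]
      norm_num [sq_abs]
      ring
  have hWc : Continuous (fun x => |U x| ^ (p + 1)) :=
    hUc.abs.rpow_const fun x => Or.inr (by linarith)
  have hW0 : ∀ x ∉ Ω, |U x| ^ (p + 1) = 0 := fun x hx => by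
    rw [hU0 x hx, abs_zero, Real.zero_rpow (by linarith)]
  have hWi := hi _ hWc hW0
  obtain ⟨C, hC, hGG⟩ := GG_ineq hp B
  obtain ⟨R, hR⟩ := hΩb.exists_norm_le
  have hDm : ∀ i, Measurable (Ω.indicator (pd u i)) := fun i =>
    (measurable_fderiv_apply_const ℝ u _).indicator hΩ.measurableSet
  have hΩfin : volume Ω < ⊤ := hΩb.measure_lt_top
  have hbi : ∀ c : ℝ, Integrable (Ω.indicator fun _ => c) := fun c =>
    (integrable_indicator_iff hΩ.measurableSet).2 (integrableOn_const hΩfin.ne)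
  have hDb : ∀ i x, |Ω.indicator (pd u i) x| ≤ M := by
    intro i x
    by_cases hx : x ∈ Ω
    · rw [indicator_of_mem hx]
      refine ((fderiv ℝ u x).le_opNorm _).trans ?_
      simpa using hM x hx
    · rw [indicator_of_notMem hx, abs_zero]; exact hM0.le
  have hDi : ∀ i, Integrable (fun x => Ω.indicator (pd u i) x ^ 2) := by
    intro i
    refine (hbi (M ^ 2)).mono' ((hDm i).pow_const 2).aestronglyMeasurable (.of_forall fun x => ?_)
    by_cases hx : x ∈ Ω
    · rw [indicator_of_mem hx (fun _ => M ^ 2), norm_pow]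
      exact pow_le_pow_left₀ (norm_nonneg _) (hDb i x) 2
    · rw [indicator_of_notMem hx, indicator_of_notMem hx]; simp
  set A := ∫ x, |U x| ^ (p + 1) with hA
  have hA1 : ∑ i, ∫ x, Ω.indicator (pd u i) x ^ 2 = A := by
    have := hw 1 le_rfl
    simp only [one_smul, one_mul, hgU] at this
    rw [hA, ← this]
    simp only [sq]
  refine ⟨A, C * ((M * R) ^ 2 * ∫ x, Ω.indicator (fun _ => (1 : ℝ)) x), ?_, ?_⟩
  · obtain ⟨x, hx, hux⟩ := hex
    refine hWc.integral_pos_of_hasCompactSupport_nonneg_nonzero (hcs _ hW0)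
      (fun x => by positivity) (x := x) ?_
    rw [hU, indicator_of_mem hx]
    exact (Real.rpow_pos_of_pos (abs_pos.2 hux) _).ne'
  intro l hl
  have hl0 : 0 < l := by linarith
  have hout : ∀ x ∉ Ω, l • x ∉ Ω := by
    intro x hx h
    apply hx
    have := hstar.smul_mem h (inv_nonneg.2 hl0.le) (inv_le_one_of_one_le₀ hl)
    rwa [smul_smul, inv_mul_cancel₀ hl0.ne', one_smul] at this
  have hVc : Continuous (fun x => U (l • x)) := hUc.comp (continuous_const_smul l)
  have hV0 : ∀ x ∉ Ω, U (l • x) = 0 := fun x hx => hU0 _ (hout x hx)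
  have hfr : Module.finrank ℝ (Euc n) = n := by simp
  -- upper bound
  have hup : ∫ x, gg p (U x) * U (l • x) ≤ 1 / 2 * A + 1 / 2 * (l ^ 2 * (l ^ n)⁻¹ * A) := by
    rw [← hw l hl]
    have hstep : ∀ i, ∫ x, Ω.indicator (pd u i) x * (l * Ω.indicator (pd u i) (l • x)) ≤
        1 / 2 * (∫ x, Ω.indicator (pd u i) x ^ 2) +
        1 / 2 * (l ^ 2 * (l ^ n)⁻¹ * ∫ x, Ω.indicator (pd u i) x ^ 2) := by
      intro i
      have hsc : ∫ x, Ω.indicator (pd u i) (l • x) ^ 2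
          = (l ^ n)⁻¹ * ∫ x, Ω.indicator (pd u i) x ^ 2 := by
        have := Measure.integral_comp_smul_of_nonneg volume
          (fun x => Ω.indicator (pd u i) x ^ 2) l (hR := hl0.le)
        rwa [hfr, smul_eq_mul] at this
      have hi2 : Integrable (fun x => Ω.indicator (pd u i) (l • x) ^ 2) :=
        (hDi i).comp_smul hl0.ne'
      rw [mul_assoc (l ^ 2), ← hsc, ← mul_assoc, ← integral_const_mul, ← integral_const_mul,
        ← integral_add ((hDi i).const_mul _) (hi2.const_mul _)]
      have hsi := ((hDi i).const_mul (1 / 2)).fun_add (hi2.const_mul (1 / 2 * l ^ 2))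
      have hms : AEStronglyMeasurable
          (fun x => Ω.indicator (pd u i) x * (l * Ω.indicator (pd u i) (l • x))) volume :=
        ((hDm i).mul (((hDm i).comp (measurable_const_smul l)).const_mul l)).aestronglyMeasurable
      refine integral_mono (hsi.mono' hms (.of_forall fun x => ?_)) hsi fun x => ?_
      · rw [Real.norm_eq_abs, abs_le]
        constructor <;>
        nlinarith [sq_nonneg (Ω.indicator (pd u i) x - l * Ω.indicator (pd u i) (l • x)),
          sq_nonneg (Ω.indicator (pd u i) x + l * Ω.indicator (pd u i) (l • x))]
      · simp only
        nlinarith [sq_nonneg (Ω.indicator (pd u i) x - l * Ω.indicator (pd u i) (l • x))]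
    refine (Finset.sum_le_sum fun i _ => hstep i).trans (le_of_eq ?_)
    rw [Finset.sum_add_distrib, ← Finset.mul_sum, ← Finset.mul_sum, ← Finset.mul_sum, hA1]
  -- lower bound
  have hVW : ∫ x, |U (l • x)| ^ (p + 1) = (l ^ n)⁻¹ * A := by
    have := Measure.integral_comp_smul_of_nonneg volume
      (fun x => |U x| ^ (p + 1)) l (hR := hl0.le)
    rwa [hfr, smul_eq_mul] at this
  have hVWi : Integrable (fun x => |U (l • x)| ^ (p + 1)) := hWi.comp_smul hl0.ne'
  have hgi1 : Integrable (fun x => gg p (U x) * U (l • x)) :=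
    hi _ ((hg.comp hUc).mul hVc) (fun x hx => by rw [hV0 x hx, mul_zero])
  have hlow : ∫ x, (|U (l • x)| ^ (p + 1) / (p + 1) - |U x| ^ (p + 1) / (p + 1)) ≤
      ∫ x, ((gg p (U x) * U (l • x) - |U x| ^ (p + 1)) +
        C * ((M * R) ^ 2 * (l - 1) ^ 2) * Ω.indicator (fun _ => (1 : ℝ)) x) := by
    refine integral_mono ((hVWi.div_const _).sub (hWi.div_const _))
      ((hgi1.sub hWi).add ((hbi 1).const_mul _)) fun x => ?_
    by_cases hx : x ∈ Ω
    · have h1 := hGG (U x) (U (l • x)) (hB _) (hB _)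
      have h2 := hlip.dist_le_mul (l • x) x
      rw [Real.coe_toNNReal _ hM0.le, Real.dist_eq, dist_eq_norm,
        show l • x - x = (l - 1) • x by rw [sub_smul, one_smul], norm_smul, Real.norm_eq_abs,
        abs_of_nonneg (by linarith : 0 ≤ l - 1)] at h2
      have h3 : |U (l • x) - U x| ≤ M * ((l - 1) * R) := h2.trans
        (mul_le_mul_of_nonneg_left (mul_le_mul_of_nonneg_left (hR x hx) (by linarith)) hM0.le)
      have h4 : (U (l • x) - U x) ^ 2 ≤ (M * R) ^ 2 * (l - 1) ^ 2 := by
        rw [← sq_abs]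
        refine (pow_le_pow_left₀ (abs_nonneg _) h3 2).trans (le_of_eq (by ring))
      have h5 := mul_le_mul_of_nonneg_left h4 hC
      have h6 := hgU (U x)
      simp only [indicator_of_mem hx]
      rw [mul_sub, h6] at h1
      linarith
    · simp only [indicator_of_notMem hx, hV0 x hx, hU0 x hx]
      simp [Real.zero_rpow (by linarith : p + 1 ≠ 0)]
  have hsb : Integrable (fun x => gg p (U x) * U (l • x) - |U x| ^ (p + 1)) := hgi1.sub hWi
  rw [integral_sub (hVWi.div_const _) (hWi.div_const _), integral_div, integral_div, hVW,
    integral_add hsb ((hbi 1).const_mul _), integral_sub hgi1 hWi,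
    integral_const_mul, ← hA] at hlow
  have e : ((l ^ n)⁻¹ - 1) / (p + 1) * A = (l ^ n)⁻¹ * A / (p + 1) - A / (p + 1) := by ring
  rw [e]
  linarith

/-- nonexistence of nontrivial solutions of `Δu + u|u|^{p-1} = 0`, `u = 0` on
`∂Ω`, on a bounded star-shaped domain in the supercritical case `p > (n+2)/(n-2)`. -/
theorem stmt3 {n : ℕ} (hn : 3 ≤ n) (Ω : Set (Euc n)) (hΩ : IsOpen Ω)
    (hΩb : Bornology.IsBounded Ω) (hstar : StarConvex ℝ (0 : Euc n) Ω)
    (p : ℝ) (hp : p > (n + 2) / (n - 2)) :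
    ¬ ∃ u : Euc n → ℝ,
        ContDiffOn ℝ 2 u Ω ∧ ContDiffOn ℝ 1 u (closure Ω) ∧
        (∀ x ∈ Ω, lap u x + u x * |u x| ^ (p - 1) = 0) ∧
        (∀ x ∈ frontier Ω, u x = 0) ∧
        (∃ x ∈ Ω, u x ≠ 0) := by
  rintro ⟨u, hu, hu1, heq, h0, hex⟩
  have hn3 : (3 : ℝ) ≤ n := by exact_mod_cast hn
  have hn2 : (0 : ℝ) < n - 2 := by linarith
  have hp' : (n : ℝ) + 2 < p * (n - 2) := (div_lt_iff₀ hn2).1 hp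
  have hp1 : 1 < p := by
    by_contra h
    have : p * (n - 2) ≤ 1 * (n - 2) := mul_le_mul_of_nonneg_right (not_lt.1 h) hn2.le
    linarith
  have : Nonempty (Fin n) := ⟨⟨0, by omega⟩⟩
  have hne : (Ωᶜ).Nonempty := by
    rw [nonempty_compl]
    rintro rfl
    exact NormedSpace.unbounded_univ ℝ (Euc n) hΩb
  obtain ⟨A, C, hA, h⟩ := main_ineq hΩ hΩb hstar hu hu1 hp1 heq h0 hne hex
  have hf := final_calc h
  have hpp : 0 < p + 1 := by linarith
  have hlt : (n : ℝ) / (p + 1) < 1 / 2 * (n - 2) := by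
    rw [div_lt_iff₀ hpp]
    nlinarith
  have := mul_lt_mul_of_pos_right hlt hA
  linarith
end
end
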